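/- Suppose A₀ and A₁ are jointly definite, i.e., there exist μ₀, μ₁ ∈ ℝ such that μ₀A₀ + μ₁A₁ is positive definite, and suppose n ≥ 2. Then a vector x* is a local-nonglobal minimizer of (GTR) if and only if x* is a local-nonglobal minimizer of (GTRE) whose Lagrangian multiplier is positive, i.e., there exists μ* > 0 with (A₀x* + b₀) + μ*(A₁x* + b₁) = 0. -/

import Mathlib

open Matrix Finset

/-- Euclidean norm of a vector in `Fin n → ℝ`. -/
noncomputable def euclNorm {n : ℕ} (x : Fin n → ℝ) : ℝ := Real.sqrt (x ⬝ᵥ x)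

/-- Objective `f₀(x) = xᵀA₀x + 2b₀ᵀx`. -/
noncomputable def qf0 {n : ℕ} (A0 : Matrix (Fin n) (Fin n) ℝ) (b0 : Fin n → ℝ)
    (x : Fin n → ℝ) : ℝ := x ⬝ᵥ A0.mulVec x + 2 * (b0 ⬝ᵥ x)

/-- Constraint `f₁(x) = xᵀA₁x + 2b₁ᵀx + c₁`. -/
noncomputable def qf1 {n : ℕ} (A1 : Matrix (Fin n) (Fin n) ℝ) (b1 : Fin n → ℝ) (c1 : ℝ)
    (x : Fin n → ℝ) : ℝ := x ⬝ᵥ A1.mulVec x + 2 * (b1 ⬝ᵥ x) + c1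

/-- Local minimizer of (GTRE): feasible, and locally optimal among feasible points. -/
def IsLocalMinGTRE {n : ℕ} (A0 A1 : Matrix (Fin n) (Fin n) ℝ) (b0 b1 : Fin n → ℝ) (c1 : ℝ)
    (xs : Fin n → ℝ) : Prop :=
  qf1 A1 b1 c1 xs = 0 ∧ ∃ δ > (0:ℝ), ∀ x : Fin n → ℝ,
    qf1 A1 b1 c1 x = 0 → euclNorm (x - xs) < δ → qf0 A0 b0 xs ≤ qf0 A0 b0 x

/-- Global minimizer of (GTRE). -/
def IsGlobalMinGTRE {n : ℕ} (A0 A1 : Matrix (Fin n) (Fin n) ℝ) (b0 b1 : Fin n → ℝ) (c1 : ℝ)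
    (xs : Fin n → ℝ) : Prop :=
  qf1 A1 b1 c1 xs = 0 ∧ ∀ x : Fin n → ℝ, qf1 A1 b1 c1 x = 0 → qf0 A0 b0 xs ≤ qf0 A0 b0 x

/-- Local-nonglobal minimizer of (GTRE). -/
def IsLNGMinGTRE {n : ℕ} (A0 A1 : Matrix (Fin n) (Fin n) ℝ) (b0 b1 : Fin n → ℝ) (c1 : ℝ)
    (xs : Fin n → ℝ) : Prop :=
  IsLocalMinGTRE A0 A1 b0 b1 c1 xs ∧ ¬ IsGlobalMinGTRE A0 A1 b0 b1 c1 xs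

/-- Strict local minimizer of (GTRE). -/
def IsStrictLocalMinGTRE {n : ℕ} (A0 A1 : Matrix (Fin n) (Fin n) ℝ) (b0 b1 : Fin n → ℝ)
    (c1 : ℝ) (xs : Fin n → ℝ) : Prop :=
  qf1 A1 b1 c1 xs = 0 ∧ ∃ δ > (0:ℝ), ∀ x : Fin n → ℝ,
    qf1 A1 b1 c1 x = 0 → x ≠ xs → euclNorm (x - xs) < δ → qf0 A0 b0 xs < qf0 A0 b0 x

/-- Strict local-nonglobal minimizer of (GTRE). -/
def IsStrictLNGMinGTRE {n : ℕ} (A0 A1 : Matrix (Fin n) (Fin n) ℝ) (b0 b1 : Fin n → ℝ)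
    (c1 : ℝ) (xs : Fin n → ℝ) : Prop :=
  IsStrictLocalMinGTRE A0 A1 b0 b1 c1 xs ∧ ¬ IsGlobalMinGTRE A0 A1 b0 b1 c1 xs

/-- Local minimizer of (GTR). -/
def IsLocalMinGTR {n : ℕ} (A0 A1 : Matrix (Fin n) (Fin n) ℝ) (b0 b1 : Fin n → ℝ) (c1 : ℝ)
    (xs : Fin n → ℝ) : Prop :=
  qf1 A1 b1 c1 xs ≤ 0 ∧ ∃ δ > (0:ℝ), ∀ x : Fin n → ℝ,
    qf1 A1 b1 c1 x ≤ 0 → euclNorm (x - xs) < δ → qf0 A0 b0 xs ≤ qf0 A0 b0 x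

/-- Global minimizer of (GTR). -/
def IsGlobalMinGTR {n : ℕ} (A0 A1 : Matrix (Fin n) (Fin n) ℝ) (b0 b1 : Fin n → ℝ) (c1 : ℝ)
    (xs : Fin n → ℝ) : Prop :=
  qf1 A1 b1 c1 xs ≤ 0 ∧ ∀ x : Fin n → ℝ, qf1 A1 b1 c1 x ≤ 0 → qf0 A0 b0 xs ≤ qf0 A0 b0 x

/-- Local-nonglobal minimizer of (GTR). -/
def IsLNGMinGTR {n : ℕ} (A0 A1 : Matrix (Fin n) (Fin n) ℝ) (b0 b1 : Fin n → ℝ) (c1 : ℝ)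
    (xs : Fin n → ℝ) : Prop :=
  IsLocalMinGTR A0 A1 b0 b1 c1 xs ∧ ¬ IsGlobalMinGTR A0 A1 b0 b1 c1 xs

/-- Strict local minimizer of (GTR). -/
def IsStrictLocalMinGTR {n : ℕ} (A0 A1 : Matrix (Fin n) (Fin n) ℝ) (b0 b1 : Fin n → ℝ)
    (c1 : ℝ) (xs : Fin n → ℝ) : Prop :=
  qf1 A1 b1 c1 xs ≤ 0 ∧ ∃ δ > (0:ℝ), ∀ x : Fin n → ℝ,
    qf1 A1 b1 c1 x ≤ 0 → x ≠ xs → euclNorm (x - xs) < δ → qf0 A0 b0 xs < qf0 A0 b0 x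

/-- Strict local-nonglobal minimizer of (GTR). -/
def IsStrictLNGMinGTR {n : ℕ} (A0 A1 : Matrix (Fin n) (Fin n) ℝ) (b0 b1 : Fin n → ℝ)
    (c1 : ℝ) (xs : Fin n → ℝ) : Prop :=
  IsStrictLocalMinGTR A0 A1 b0 b1 c1 xs ∧ ¬ IsGlobalMinGTR A0 A1 b0 b1 c1 xs

open Filter Topology

/-- The quadratic form `d ↦ dᵀAd`. -/
def quadForm {n : ℕ} (A : Matrix (Fin n) (Fin n) ℝ) (d : Fin n → ℝ) : ℝ := d ⬝ᵥ A *ᵥ d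

section quadForm

variable {n : ℕ} {A A0 A1 : Matrix (Fin n) (Fin n) ℝ}

lemma dotProduct_mulVec_swap (hA : A.IsSymm) (v w : Fin n → ℝ) :
    v ⬝ᵥ A *ᵥ w = w ⬝ᵥ A *ᵥ v := by
  rw [dotProduct_comm, dotProduct_mulVec, ← mulVec_transpose, hA.eq, dotProduct_comm,
    dotProduct_comm]

lemma quadForm_smul (t : ℝ) (d : Fin n → ℝ) : quadForm A (t • d) = t ^ 2 * quadForm A d := by
  simp only [quadForm, mulVec_smul, smul_dotProduct, dotProduct_smul, smul_eq_mul]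
  ring

lemma quadForm_neg (d : Fin n → ℝ) : quadForm A (-d) = quadForm A d := by
  simp [quadForm, mulVec_neg]

lemma quadForm_smul_add_smul (hA : A.IsSymm) (t s : ℝ) (v w : Fin n → ℝ) :
    quadForm A (t • v + s • w)
      = t ^ 2 * quadForm A v + 2 * s * t * (w ⬝ᵥ A *ᵥ v) + s ^ 2 * quadForm A w := by
  simp only [quadForm, mulVec_add, mulVec_smul, add_dotProduct, dotProduct_add, smul_dotProduct,
    dotProduct_smul, smul_eq_mul]
  rw [dotProduct_mulVec_swap hA v w]
  ring

lemma quadForm_add_smul (a b : ℝ) (d : Fin n → ℝ) :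
    quadForm (a • A0 + b • A1) d = a * quadForm A0 d + b * quadForm A1 d := by
  simp only [quadForm, add_mulVec, smul_mulVec, dotProduct_add, dotProduct_smul, smul_eq_mul]

lemma continuous_quadForm : Continuous (quadForm A) := by
  unfold quadForm
  fun_prop

lemma qf0_add (hA : A.IsSymm) (b x d : Fin n → ℝ) :
    qf0 A b (x + d) = qf0 A b x + (quadForm A d + 2 * ((A *ᵥ x + b) ⬝ᵥ d)) := by
  simp only [qf0, quadForm, mulVec_add, add_dotProduct, dotProduct_add]
  rw [dotProduct_mulVec_swap hA x d, dotProduct_comm (A *ᵥ x) d]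
  ring

lemma qf1_add (hA : A.IsSymm) (b x d : Fin n → ℝ) (c : ℝ) :
    qf1 A b c (x + d) = qf1 A b c x + (quadForm A d + 2 * ((A *ᵥ x + b) ⬝ᵥ d)) := by
  have := qf0_add hA b x d
  simp only [qf0] at this
  simp only [qf1]
  linarith

lemma continuous_euclNorm : Continuous (euclNorm : (Fin n → ℝ) → ℝ) := by
  unfold euclNorm
  fun_prop

lemma norm_le_euclNorm (d : Fin n → ℝ) : ‖d‖ ≤ euclNorm d := by
  refine (pi_norm_le_iff_of_nonneg (Real.sqrt_nonneg _)).2 fun i => ?_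
  refine Real.le_sqrt_of_sq_le ?_
  rw [Real.norm_eq_abs, sq_abs, dotProduct, sq]
  exact Finset.single_le_sum (f := fun i => d i * d i) (fun j _ => mul_self_nonneg _)
    (Finset.mem_univ i)

lemma exists_euclNorm_lt_iff (P Q : (Fin n → ℝ) → Prop) (x₀ : Fin n → ℝ) :
    (∃ δ > (0 : ℝ), ∀ x, P x → euclNorm (x - x₀) < δ → Q x) ↔
      ∀ᶠ d in 𝓝 (0 : Fin n → ℝ), P (x₀ + d) → Q (x₀ + d) := by
  constructor
  · rintro ⟨δ, hδ, h⟩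
    have h0 : euclNorm (0 : Fin n → ℝ) < δ := by simpa [euclNorm] using hδ
    filter_upwards [continuous_euclNorm.continuousAt.eventually_lt continuousAt_const h0]
      with d hd hP
    exact h _ hP (by simpa using hd)
  · intro h
    obtain ⟨δ, hδ, h⟩ := Metric.eventually_nhds_iff.1 h
    refine ⟨δ, hδ, fun x hP hx => ?_⟩
    have := @h (x - x₀) (by simpa using (norm_le_euclNorm _).trans_lt hx)
    simp only [add_sub_cancel] at this
    exact this hP

lemma exists_quadForm_abs_le (A : Matrix (Fin n) (Fin n) ℝ) :
    ∃ C > 0, ∀ d, |quadForm A d| ≤ C * ‖d‖ ^ 2 := by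
  obtain ⟨C, hC⟩ := (isCompact_sphere (0 : Fin n → ℝ) 1).exists_bound_of_continuousOn
    (continuous_quadForm (A := A)).continuousOn
  refine ⟨max C 1, by positivity, fun d => ?_⟩
  rcases eq_or_ne d 0 with rfl | hd
  · simp [quadForm]
  have hd' : ‖d‖ ≠ 0 := norm_ne_zero_iff.2 hd
  have h := hC (‖d‖⁻¹ • d) (by simp [norm_smul, hd'])
  rw [quadForm_smul, Real.norm_eq_abs, abs_mul, abs_of_nonneg (by positivity : 0 ≤ ‖d‖⁻¹ ^ 2),
    inv_pow, inv_mul_le_iff₀ (by positivity)] at h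
  nlinarith [le_max_left C 1, sq_nonneg ‖d‖]

lemma exists_dotProduct_abs_le (g : Fin n → ℝ) : ∃ G > 0, ∀ d, |g ⬝ᵥ d| ≤ G * ‖d‖ := by
  refine ⟨∑ i, |g i| + 1, by positivity, fun d => ?_⟩
  have : |g ⬝ᵥ d| ≤ (∑ i, |g i|) * ‖d‖ := by
    rw [dotProduct, Finset.sum_mul]
    refine (Finset.abs_sum_le_sum_abs _ _).trans (Finset.sum_le_sum fun i _ => ?_)
    rw [abs_mul]
    exact mul_le_mul_of_nonneg_left (norm_le_pi_norm d i) (abs_nonneg _)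
  nlinarith [norm_nonneg d]

/-- Finsler's lemma, in quantitative form. -/
lemma exists_quadForm_add_sq_ge (A : Matrix (Fin n) (Fin n) ℝ) (g : Fin n → ℝ)
    (h : ∀ v, v ≠ 0 → g ⬝ᵥ v = 0 → 0 < quadForm A v) :
    ∃ κ > 0, ∃ c > 0, ∀ d, c * ‖d‖ ^ 2 ≤ quadForm A d + κ * (g ⬝ᵥ d) ^ 2 := by
  obtain ⟨C, hC, hAC⟩ := exists_quadForm_abs_le A
  have hS := isCompact_sphere (0 : Fin n → ℝ) 1
  have hgc : Continuous fun d : Fin n → ℝ => (g ⬝ᵥ d) ^ 2 := by fun_prop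
  have hne : ∀ d ∈ Metric.sphere (0 : Fin n → ℝ) 1, d ≠ 0 := by
    rintro d hd rfl
    simp at hd
  obtain ⟨ε, hε, hK⟩ : ∃ ε > 0, ∀ d ∈ Metric.sphere (0 : Fin n → ℝ) 1,
      quadForm A d ≤ 0 → ε ≤ (g ⬝ᵥ d) ^ 2 := by
    have hKc : IsCompact (Metric.sphere (0 : Fin n → ℝ) 1 ∩ {d | quadForm A d ≤ 0}) :=
      hS.inter_right (isClosed_le continuous_quadForm continuous_const)
    rcases Set.eq_empty_or_nonempty (Metric.sphere (0 : Fin n → ℝ) 1 ∩ {d | quadForm A d ≤ 0})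
      with he | hn
    · exact ⟨1, one_pos, fun d hd hq => (Set.eq_empty_iff_forall_notMem.1 he d ⟨hd, hq⟩).elim⟩
    · obtain ⟨d₀, ⟨hd₀, hq₀⟩, hmin⟩ := hKc.exists_isMinOn hn hgc.continuousOn
      refine ⟨(g ⬝ᵥ d₀) ^ 2, ?_, fun d hd hq => hmin ⟨hd, hq⟩⟩
      have : g ⬝ᵥ d₀ ≠ 0 := fun h0 => (h d₀ (hne _ hd₀) h0).not_ge hq₀
      positivity
  set κ := (C + 1) / ε with hκ
  have hκε : κ * ε = C + 1 := by rw [hκ]; field_simp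
  have hκ0 : 0 < κ := by positivity
  have hpos : ∀ d ∈ Metric.sphere (0 : Fin n → ℝ) 1,
      0 < quadForm A d + κ * (g ⬝ᵥ d) ^ 2 := by
    intro d hd
    rcases le_or_gt (quadForm A d) 0 with hq | hq
    · have h1 := hK d hd hq
      have h2 := hAC d
      rw [mem_sphere_zero_iff_norm.1 hd] at h2
      nlinarith [neg_abs_le (quadForm A d)]
    · positivity
  obtain ⟨c, hc, hcS⟩ : ∃ c > 0, ∀ d ∈ Metric.sphere (0 : Fin n → ℝ) 1,
      c ≤ quadForm A d + κ * (g ⬝ᵥ d) ^ 2 := by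
    rcases Set.eq_empty_or_nonempty (Metric.sphere (0 : Fin n → ℝ) 1) with he | hn
    · exact ⟨1, one_pos, fun d hd => (he ▸ hd : d ∈ (∅ : Set _)).elim⟩
    · obtain ⟨d₀, hd₀, hmin⟩ := hS.exists_isMinOn hn
        (continuous_quadForm (A := A) |>.add (hgc.const_mul κ)).continuousOn
      exact ⟨_, hpos d₀ hd₀, fun d hd => hmin hd⟩
  refine ⟨κ, hκ0, c, hc, fun d => ?_⟩
  rcases eq_or_ne d 0 with rfl | hd
  · simp [quadForm]
  have hd' : ‖d‖ ≠ 0 := norm_ne_zero_iff.2 hd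
  have h := hcS (‖d‖⁻¹ • d) (by simp [norm_smul, hd'])
  rw [quadForm_smul, dotProduct_smul, smul_eq_mul] at h
  have h2 := mul_le_mul_of_nonneg_right h (sq_nonneg ‖d‖)
  refine h2.trans_eq ?_
  field_simp

lemma eventually_comp_smul {P : (Fin n → ℝ) → Prop} (h : ∀ᶠ d in 𝓝 0, P d) (d : Fin n → ℝ) :
    ∀ᶠ t : ℝ in 𝓝 0, P (t • d) := by
  have : Tendsto (fun t : ℝ => t • d) (𝓝 0) (𝓝 0) := by
    have : Continuous fun t : ℝ => t • d := by fun_prop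
    simpa using this.tendsto 0
  exact this.eventually h

lemma nonneg_of_eventually_quadratic_nonneg {p r : ℝ}
    (h : ∀ᶠ t in 𝓝[>] (0 : ℝ), 0 ≤ t ^ 2 * p + 2 * (t * r)) : 0 ≤ r := by
  have hc : Continuous fun t : ℝ => t * p + 2 * r := by fun_prop
  have ht : Tendsto (fun t : ℝ => t * p + 2 * r) (𝓝[>] 0) (𝓝 (2 * r)) := by
    simpa using (hc.tendsto 0).mono_left nhdsWithin_le_nhds
  have : 0 ≤ 2 * r := by
    refine ge_of_tendsto ht ?_
    filter_upwards [h, self_mem_nhdsWithin] with t h0 (htp : 0 < t)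
    refine nonneg_of_mul_nonneg_right (a := t) ?_ htp
    linarith
  linarith

lemma eq_zero_and_nonneg_of_eventually_quadratic_nonneg {p r : ℝ}
    (h : ∀ᶠ t in 𝓝 (0 : ℝ), 0 ≤ t ^ 2 * p + 2 * (t * r)) : r = 0 ∧ 0 ≤ p := by
  have hneg : ∀ᶠ t in 𝓝 (0 : ℝ), 0 ≤ t ^ 2 * p + 2 * (t * -r) := by
    have : Tendsto (fun t : ℝ => -t) (𝓝 0) (𝓝 0) := by
      simpa using (continuous_neg (G := ℝ)).tendsto 0
    filter_upwards [this.eventually h] with t ht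
    linarith
  have h1 := nonneg_of_eventually_quadratic_nonneg (h.filter_mono nhdsWithin_le_nhds)
  have h2 := nonneg_of_eventually_quadratic_nonneg (hneg.filter_mono nhdsWithin_le_nhds)
  have hr : r = 0 := by linarith
  refine ⟨hr, ?_⟩
  obtain ⟨t, ht, htp⟩ := ((h.filter_mono nhdsWithin_le_nhds).and
    (self_mem_nhdsWithin (s := Set.Ioi (0 : ℝ)))).exists
  have htp : 0 < t := htp
  subst hr
  exact nonneg_of_mul_nonneg_right (a := t ^ 2) (by linarith) (by positivity)

/-- Perturbation of a direction of negative curvature off a hyperplane. -/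
lemma exists_quadForm_neg_dotProduct_ne_zero {g w : Fin n → ℝ} (hg : g ≠ 0)
    (hw : quadForm A w < 0) : ∃ w', quadForm A w' < 0 ∧ g ⬝ᵥ w' ≠ 0 := by
  by_cases h : g ⬝ᵥ w = 0
  · have hc : Continuous fun ε : ℝ => quadForm A (w + ε • g) :=
      continuous_quadForm.comp (by fun_prop)
    have hev : ∀ᶠ ε : ℝ in 𝓝 0, quadForm A (w + ε • g) < 0 :=
      hc.continuousAt.eventually_lt continuousAt_const (by simpa using hw)
    obtain ⟨ε, h1, h2⟩ := ((hev.filter_mono nhdsWithin_le_nhds).and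
      (self_mem_nhdsWithin (s := Set.Ioi (0 : ℝ)))).exists
    have h2 : 0 < ε := h2
    refine ⟨_, h1, ?_⟩
    have : g ⬝ᵥ g ≠ 0 := fun h => hg (dotProduct_self_eq_zero.1 h)
    simp [dotProduct_add, h, h2.ne', this]
  · exact ⟨w, hw, h⟩

lemma quadForm_eq_zero_of_eventually_eq_zero (hA : A.IsSymm) (w z : Fin n → ℝ)
    (h : ∀ᶠ ε : ℝ in 𝓝 0, quadForm A (w + ε • z) = 0) : quadForm A z = 0 := by
  have hneg : ∀ᶠ ε : ℝ in 𝓝 0, quadForm A (w + (-ε) • z) = 0 := by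
    have : Tendsto (fun t : ℝ => -t) (𝓝 0) (𝓝 0) := by
      simpa using (continuous_neg (G := ℝ)).tendsto 0
    exact this.eventually h
  have h0 := h.self_of_nhds
  obtain ⟨ε, ⟨h1, h2⟩, h3⟩ := (((h.and hneg).filter_mono nhdsWithin_le_nhds).and
    (self_mem_nhdsWithin (s := Set.Ioi (0 : ℝ)))).exists
  have h3 : 0 < ε := h3
  have e1 := quadForm_smul_add_smul hA 1 ε w z
  have e2 := quadForm_smul_add_smul hA 1 (-ε) w z
  rw [one_smul] at e1 e2
  rw [zero_smul, add_zero] at h0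
  have : ε ^ 2 * quadForm A z = 0 := by nlinarith
  exact (mul_eq_zero.1 this).resolve_left (by positivity)

end quadForm

/-- First-order necessary condition for local minimality over an inequality constraint with
nonvanishing gradient. -/
lemma exists_multiplier {n : ℕ} {g h : Fin n → ℝ} (hg : g ≠ 0)
    (H : ∀ d, g ⬝ᵥ d < 0 → 0 ≤ h ⬝ᵥ d) : ∃ μ : ℝ, 0 ≤ μ ∧ h + μ • g = 0 := by
  have hgg : 0 < g ⬝ᵥ g :=
    lt_of_le_of_ne (Finset.sum_nonneg fun i _ => mul_self_nonneg (g i))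
      fun h => hg (dotProduct_self_eq_zero.1 h.symm)
  have H' : ∀ d, g ⬝ᵥ d = 0 → 0 ≤ h ⬝ᵥ d := by
    intro d hd
    have hc : Continuous fun ε : ℝ => h ⬝ᵥ (d - ε • g) := by fun_prop
    have ht : Tendsto (fun ε : ℝ => h ⬝ᵥ (d - ε • g)) (𝓝[>] 0) (𝓝 (h ⬝ᵥ d)) := by
      simpa using (hc.tendsto 0).mono_left nhdsWithin_le_nhds
    refine ge_of_tendsto ht ?_
    filter_upwards [self_mem_nhdsWithin] with ε (hε : 0 < ε)
    refine H _ ?_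
    rw [dotProduct_sub, hd, dotProduct_smul, smul_eq_mul]
    nlinarith
  refine ⟨-(h ⬝ᵥ g) / (g ⬝ᵥ g), ?_, ?_⟩
  · have := H (-g) (by simpa using hgg)
    rw [dotProduct_neg] at this
    positivity
  · set μ := -(h ⬝ᵥ g) / (g ⬝ᵥ g) with hμ
    have h1 : g ⬝ᵥ (h + μ • g) = 0 := by
      rw [dotProduct_add, dotProduct_smul, smul_eq_mul, hμ, dotProduct_comm g h]
      field_simp
      ring
    have h2 := H' (-(h + μ • g)) (by rw [dotProduct_neg, h1, neg_zero])
    have h3 : (h + μ • g) ⬝ᵥ (h + μ • g) = h ⬝ᵥ (h + μ • g) := by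
      conv_lhs => rw [add_dotProduct, smul_dotProduct, h1]
      simp
    refine dotProduct_self_eq_zero.1 (le_antisymm ?_ ?_)
    · rw [dotProduct_neg] at h2
      linarith
    · exact Finset.sum_nonneg fun i _ => mul_self_nonneg _

section Local

variable {n : ℕ} {A0 A1 : Matrix (Fin n) (Fin n) ℝ} {g h : Fin n → ℝ} {μ : ℝ}

/-- Along a constraint with quadratic part `A1` and gradient `g`, a direction tangent to the
constraint that is not strictly convex for the Lagrangian, combined with a transversal direction of
negative curvature, contradicts local minimality. -/
lemma not_eventually_of_degenerate_tangent (hA0 : A0.IsSymm) (hA1 : A1.IsSymm)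
    (hμ : h + μ • g = 0)
    (hloc : ∀ᶠ d in 𝓝 (0 : Fin n → ℝ), quadForm A1 d + 2 * (g ⬝ᵥ d) = 0 →
      0 ≤ quadForm A0 d + 2 * (h ⬝ᵥ d))
    {v w : Fin n → ℝ} (hgv : g ⬝ᵥ v = 0) (hgw : g ⬝ᵥ w ≠ 0) (hv1 : quadForm A1 v ≠ 0)
    (hv : quadForm A0 v + μ * quadForm A1 v ≤ 0) (hw : quadForm A0 w + μ * quadForm A1 w < 0) :
    False := by
  set α := quadForm A1 v with hα
  set k := g ⬝ᵥ w with hk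
  set γ := quadForm A1 w with hγ
  set β := w ⬝ᵥ A1 *ᵥ v with hβ
  set q := w ⬝ᵥ A0 *ᵥ v + μ * β with hq
  obtain ⟨σ, hσ2, hσ⟩ : ∃ σ : ℝ, σ ^ 2 = 1 ∧ 0 ≤ σ * (k * q) := by
    rcases le_total 0 (k * q) with h | h
    · exact ⟨1, by norm_num, by linarith⟩
    · exact ⟨-1, by norm_num, by linarith⟩
  have hh : h = -(μ • g) := eq_neg_of_add_eq_zero_left hμ
  let s : ℝ → ℝ := fun ε => -ε * α * k
  let D : ℝ → ℝ := fun ε => (s ε * β) ^ 2 - α * (s ε ^ 2 * γ + 2 * s ε * k)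
  let t : ℝ → ℝ := fun ε => (-(s ε * β) + σ * √(D ε)) / α
  have hcont : Continuous fun ε => t ε • v + s ε • w := by
    simp only [t, D, s]
    fun_prop
  have htend : Tendsto (fun ε => t ε • v + s ε • w) (𝓝[>] 0) (𝓝 0) := by
    have h0 : t 0 • v + s 0 • w = 0 := by simp [t, D, s]
    have := (hcont.tendsto 0).mono_left (nhdsWithin_le_nhds (s := Set.Ioi 0))
    rwa [h0] at this
  have hsmall : ∀ᶠ ε in 𝓝[>] (0 : ℝ), ε * (α * γ) < 2 := by
    have hc : Continuous fun ε : ℝ => ε * (α * γ) := by fun_prop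
    exact (hc.continuousAt.eventually_lt continuousAt_const (by simp)).filter_mono
      nhdsWithin_le_nhds
  obtain ⟨ε, ⟨hε, hε2⟩, hε0⟩ := ((htend.eventually hloc).and hsmall |>.and
    (self_mem_nhdsWithin (s := Set.Ioi (0 : ℝ)))).exists
  have hε0 : 0 < ε := hε0
  have hC : α * (s ε ^ 2 * γ + 2 * s ε * k) < 0 := by
    have e : α * (s ε ^ 2 * γ + 2 * s ε * k) = (ε * α ^ 2 * k ^ 2) * (ε * (α * γ) - 2) := by
      simp only [s]
      ring
    rw [e]
    exact mul_neg_of_pos_of_neg (by positivity) (by linarith)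
  have hD : (s ε * β) ^ 2 < D ε := by
    simp only [D]
    linarith
  have hD0 : 0 ≤ D ε := (sq_nonneg _).trans hD.le
  have hsqrt : √(D ε) ^ 2 = D ε := Real.sq_sqrt hD0
  have hsβ : |s ε * β| < √(D ε) := by
    rw [← Real.sqrt_sq_eq_abs]
    exact Real.sqrt_lt_sqrt (sq_nonneg _) hD
  have hαt : α * t ε = -(s ε * β) + σ * √(D ε) := by
    simp only [t]
    field_simp
  have hroot : t ε ^ 2 * α + 2 * s ε * t ε * β + s ε ^ 2 * γ + 2 * (s ε * k) = 0 := by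
    have e : α * (t ε ^ 2 * α + 2 * s ε * t ε * β + s ε ^ 2 * γ + 2 * (s ε * k))
        = (α * t ε + s ε * β) ^ 2 - D ε := by
      simp only [D]
      ring
    have e' : (α * t ε + s ε * β) ^ 2 - D ε = 0 := by
      rw [hαt]
      linear_combination √(D ε) ^ 2 * hσ2 + hsqrt
    rw [e'] at e
    exact (mul_eq_zero.1 e).resolve_left hv1
  have hcross : s ε * t ε * q ≤ 0 := by
    have e : s ε * t ε * q = -(ε * ((α * t ε) * (k * q))) := by
      simp only [s]
      ring
    rw [e, hαt]
    have hb := abs_lt.1 hsβ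
    have hσ' : σ = 1 ∨ σ = -1 := by simpa using hσ2
    have : 0 ≤ (-(s ε * β) + σ * √(D ε)) * (k * q) := by
      rcases hσ' with rfl | rfl
      · exact mul_nonneg (by linarith) (by linarith)
      · exact mul_nonneg_of_nonpos_of_nonpos (by linarith) (by linarith)
    nlinarith
  have hs : s ε ≠ 0 := by simp [s, hε0.ne', hv1, hgw]
  have hgd : g ⬝ᵥ (t ε • v + s ε • w) = s ε * k := by
    simp [dotProduct_add, hgv, hk]
  have hhd : h ⬝ᵥ (t ε • v + s ε • w) = -(μ * (s ε * k)) := by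
    rw [hh, neg_dotProduct, smul_dotProduct, hgd, smul_eq_mul]
  rw [hgd, hhd, quadForm_smul_add_smul hA0, quadForm_smul_add_smul hA1, ← hα, ← hβ, ← hγ] at hε
  have hfin := hε hroot
  have h1 := mul_nonneg (sq_nonneg (t ε)) (neg_nonneg.2 hv)
  have h2 : s ε ^ 2 * (quadForm A0 w + μ * γ) < 0 := mul_neg_of_pos_of_neg (by positivity) hw
  simp only [hq] at hcross
  have hfin' := congrArg (μ * ·) hroot
  simp only [mul_zero] at hfin'
  linarith

/-- Positive definiteness of the Lagrangian on the tangent space at a local minimizer over an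
equality constraint at which the Lagrangian has a direction of negative curvature. -/
lemma quadForm_pos_on_tangent (hA0 : A0.IsSymm) (hA1 : A1.IsSymm)
    (hjoint : ∃ μ0 μ1 : ℝ, (μ0 • A0 + μ1 • A1).PosDef) (hg : g ≠ 0) (hμ : h + μ • g = 0)
    (hloc : ∀ᶠ d in 𝓝 (0 : Fin n → ℝ), quadForm A1 d + 2 * (g ⬝ᵥ d) = 0 →
      0 ≤ quadForm A0 d + 2 * (h ⬝ᵥ d))
    {w : Fin n → ℝ} (hw : quadForm (A0 + μ • A1) w < 0) {v : Fin n → ℝ} (hv0 : v ≠ 0)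
    (hgv : g ⬝ᵥ v = 0) : 0 < quadForm (A0 + μ • A1) v := by
  have hM : ∀ d, quadForm (A0 + μ • A1) d = quadForm A0 d + μ * quadForm A1 d := fun d => by
    simpa using quadForm_add_smul (A0 := A0) (A1 := A1) 1 μ d
  obtain ⟨w', hw', hgw'⟩ := exists_quadForm_neg_dotProduct_ne_zero hg hw
  rw [hM] at hw' ⊢
  by_contra! hv
  by_cases hv1 : quadForm A1 v = 0
  · have hhv : h ⬝ᵥ v = 0 := by
      rw [eq_neg_of_add_eq_zero_left hμ, neg_dotProduct, smul_dotProduct, hgv, smul_zero, neg_zero]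
    have h0 : 0 ≤ quadForm A0 v := by
      refine (eq_zero_and_nonneg_of_eventually_quadratic_nonneg (r := 0) ?_).2
      filter_upwards [eventually_comp_smul hloc v] with t ht
      simpa [quadForm_smul, hv1, hgv, hhv] using ht
    obtain ⟨μ0, μ1, hpd⟩ := hjoint
    have hpos : 0 < quadForm (μ0 • A0 + μ1 • A1) v := by
      simpa [quadForm] using hpd.dotProduct_mulVec_pos hv0
    rw [quadForm_add_smul, hv1] at hpos
    rw [hv1] at hv
    have : quadForm A0 v = 0 := by linarith
    simp [this] at hpos
  · exact not_eventually_of_degenerate_tangent hA0 hA1 hμ hloc hgv hgw' hv1 hv hw'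

/-- Second-order sufficient condition for local minimality over an inequality constraint. -/
lemma eventually_nonneg_of_quadForm_pos_on_tangent (hμ0 : 0 < μ) (hμ : h + μ • g = 0)
    (hpos : ∀ v, v ≠ 0 → g ⬝ᵥ v = 0 → 0 < quadForm (A0 + μ • A1) v) :
    ∀ᶠ d in 𝓝 (0 : Fin n → ℝ), quadForm A1 d + 2 * (g ⬝ᵥ d) ≤ 0 →
      0 ≤ quadForm A0 d + 2 * (h ⬝ᵥ d) := by
  obtain ⟨κ, hκ, c, hc, hM⟩ := exists_quadForm_add_sq_ge _ g hpos
  obtain ⟨C, hC, hA1C⟩ := exists_quadForm_abs_le A1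
  obtain ⟨G, hG, hgG⟩ := exists_dotProduct_abs_le g
  have hlim : ∀ b : ℝ, 0 < b → ∀ᶠ d in 𝓝 (0 : Fin n → ℝ), κ * G * ‖d‖ < b := by
    intro b hb
    have hcont : Continuous fun d : Fin n → ℝ => κ * G * ‖d‖ := by fun_prop
    exact hcont.continuousAt.eventually_lt continuousAt_const (by simpa using hb)
  filter_upwards [hlim μ hμ0, hlim (c / C) (by positivity)] with d hd1 hd2 hfeas
  have hMd := hM d
  rw [show A0 + μ • A1 = (1 : ℝ) • A0 + μ • A1 by rw [one_smul], quadForm_add_smul, one_mul] at hMd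
  have hhd : h ⬝ᵥ d = -(μ * (g ⬝ᵥ d)) := by
    rw [eq_neg_of_add_eq_zero_left hμ, neg_dotProduct, smul_dotProduct, smul_eq_mul]
  rw [hhd]
  set u := g ⬝ᵥ d with hu
  set φ := -(quadForm A1 d + 2 * u) with hφ
  have hφ0 : 0 ≤ φ := by linarith
  have h1 := hA1C d
  have h2 := hgG d
  have hu2 : 2 * |u| ≤ φ + C * ‖d‖ ^ 2 := by
    have e : 2 * u = -φ - quadForm A1 d := by rw [hφ]; ring
    have h3 := abs_le.1 h1
    rcases abs_cases u with ⟨h, _⟩ | ⟨h, _⟩ <;> rw [h] <;> linarith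
  have hκu : κ * u ^ 2 ≤ κ * G * ‖d‖ * (φ + C * ‖d‖ ^ 2) := by
    have h3 : |u| * |u| ≤ (G * ‖d‖) * (φ + C * ‖d‖ ^ 2) :=
      mul_le_mul h2 (by linarith [abs_nonneg u]) (abs_nonneg _) (by positivity)
    rw [abs_mul_abs_self] at h3
    nlinarith
  have h4 : κ * G * ‖d‖ * φ ≤ μ * φ := mul_le_mul_of_nonneg_right hd1.le hφ0
  have h5 : κ * G * ‖d‖ * (C * ‖d‖ ^ 2) ≤ c * ‖d‖ ^ 2 := by
    have := mul_le_mul_of_nonneg_right hd2.le (by positivity : 0 ≤ C * ‖d‖ ^ 2)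
    refine this.trans_eq ?_
    field_simp
  have e : quadForm A0 d + 2 * -(μ * u) = quadForm A0 d + μ * quadForm A1 d + μ * φ := by
    rw [hφ]; ring
  rw [e]
  linarith

/-- A local minimizer over an inequality constraint that is active with vanishing gradient is a
global minimizer. -/
lemma nonneg_of_eventually_of_gradient_eq_zero
    (hloc : ∀ᶠ d in 𝓝 (0 : Fin n → ℝ), quadForm A1 d ≤ 0 → 0 ≤ quadForm A0 d + 2 * (h ⬝ᵥ d))
    {d : Fin n → ℝ} (hd : quadForm A1 d ≤ 0) : 0 ≤ quadForm A0 d + 2 * (h ⬝ᵥ d) := by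
  obtain ⟨h1, h2⟩ := eq_zero_and_nonneg_of_eventually_quadratic_nonneg
    (p := quadForm A0 d) (r := h ⬝ᵥ d) (by
      filter_upwards [eventually_comp_smul hloc d] with t ht
      rw [quadForm_smul, quadForm_smul, dotProduct_smul, smul_eq_mul] at ht
      exact ht (mul_nonpos_of_nonneg_of_nonpos (sq_nonneg t) hd))
  rw [h1]
  linarith

/-- Karush-Kuhn-Tucker conditions at a local-nonglobal minimizer over an active inequality
constraint with nonvanishing gradient. -/
lemma exists_multiplier_pos_of_local_nonglobal (hg : g ≠ 0)
    (hloc : ∀ᶠ d in 𝓝 (0 : Fin n → ℝ), quadForm A1 d + 2 * (g ⬝ᵥ d) ≤ 0 →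
      0 ≤ quadForm A0 d + 2 * (h ⬝ᵥ d))
    (hglob : ∃ d, quadForm A1 d + 2 * (g ⬝ᵥ d) ≤ 0 ∧ quadForm A0 d + 2 * (h ⬝ᵥ d) < 0) :
    ∃ μ : ℝ, 0 < μ ∧ h + μ • g = 0 ∧ ∃ w, quadForm (A0 + μ • A1) w < 0 := by
  have hray : ∀ d, g ⬝ᵥ d < 0 →
      ∀ᶠ t in 𝓝[>] (0 : ℝ), 0 ≤ t ^ 2 * quadForm A0 d + 2 * (t * (h ⬝ᵥ d)) := by
    intro d hd
    have hc : Continuous fun t : ℝ => t * quadForm A1 d + 2 * (g ⬝ᵥ d) := by fun_prop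
    have hev : ∀ᶠ t in 𝓝[>] (0 : ℝ), t * quadForm A1 d + 2 * (g ⬝ᵥ d) < 0 :=
      (hc.continuousAt.eventually_lt continuousAt_const (by
        rw [zero_mul, zero_add]
        linarith)).filter_mono nhdsWithin_le_nhds
    filter_upwards [hev, (eventually_comp_smul hloc d).filter_mono nhdsWithin_le_nhds,
      self_mem_nhdsWithin] with t h1 h2 (h3 : 0 < t)
    rw [quadForm_smul, quadForm_smul, dotProduct_smul, dotProduct_smul, smul_eq_mul,
      smul_eq_mul] at h2
    exact h2 (by nlinarith)
  obtain ⟨μ, hμ0, hμ⟩ := exists_multiplier hg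
    fun d hd => nonneg_of_eventually_quadratic_nonneg (hray d hd)
  have hh : ∀ d, h ⬝ᵥ d = -(μ * (g ⬝ᵥ d)) := fun d => by
    rw [eq_neg_of_add_eq_zero_left hμ, neg_dotProduct, smul_dotProduct, smul_eq_mul]
  obtain ⟨d, hd1, hd2⟩ := hglob
  have hw : quadForm (A0 + μ • A1) d < 0 := by
    rw [show A0 + μ • A1 = (1 : ℝ) • A0 + μ • A1 by rw [one_smul], quadForm_add_smul]
    rw [hh] at hd2
    nlinarith
  refine ⟨μ, lt_of_le_of_ne hμ0 ?_, hμ, d, hw⟩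
  rintro rfl
  rw [zero_smul, add_zero] at hw
  obtain ⟨w, hw, hgw⟩ := exists_quadForm_neg_dotProduct_ne_zero hg hw
  have hcontra : ∀ w, quadForm A0 w < 0 → ¬ g ⬝ᵥ w < 0 := by
    intro w hw hgw
    obtain ⟨t, h1, h2⟩ := ((hray w hgw).and
      (self_mem_nhdsWithin (s := Set.Ioi (0 : ℝ)))).exists
    have h2 : 0 < t := h2
    rw [hh w] at h1
    have : 0 < t ^ 2 := by positivity
    nlinarith
  rcases lt_or_gt_of_ne hgw with h1 | h1
  · exact hcontra w hw h1
  · exact hcontra (-w) (by rwa [quadForm_neg]) (by rw [dotProduct_neg]; linarith)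

/-- A direction of negative curvature of the Lagrangian yields a better point on the equality
constraint. -/
lemma exists_neg_of_exists_quadForm_neg (hn : 2 ≤ n) (hA1 : A1.IsSymm)
    (hjoint : ∃ μ0 μ1 : ℝ, (μ0 • A0 + μ1 • A1).PosDef) (hg : g ≠ 0) (hμ : h + μ • g = 0)
    {w : Fin n → ℝ} (hw : quadForm (A0 + μ • A1) w < 0) :
    ∃ d, quadForm A1 d + 2 * (g ⬝ᵥ d) = 0 ∧ quadForm A0 d + 2 * (h ⬝ᵥ d) < 0 := by
  have hM : ∀ d, quadForm (A0 + μ • A1) d = quadForm A0 d + μ * quadForm A1 d := fun d => by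
    simpa using quadForm_add_smul (A0 := A0) (A1 := A1) 1 μ d
  have hh : ∀ d, h ⬝ᵥ d = -(μ * (g ⬝ᵥ d)) := fun d => by
    rw [eq_neg_of_add_eq_zero_left hμ, neg_dotProduct, smul_dotProduct, smul_eq_mul]
  obtain ⟨w, hw, hgw⟩ := exists_quadForm_neg_dotProduct_ne_zero hg hw
  by_cases hex : ∃ d, quadForm (A0 + μ • A1) d < 0 ∧ g ⬝ᵥ d ≠ 0 ∧ quadForm A1 d ≠ 0
  · obtain ⟨d, hd, hgd, hd1⟩ := hex
    have ht : -2 * (g ⬝ᵥ d) / quadForm A1 d * quadForm A1 d = -2 * (g ⬝ᵥ d) := by field_simp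
    set t := -2 * (g ⬝ᵥ d) / quadForm A1 d with ht_def
    have ht0 : t ≠ 0 := by
      rw [ht_def]
      simp [hgd, hd1]
    refine ⟨t • d, ?_, ?_⟩
    · rw [quadForm_smul, dotProduct_smul, smul_eq_mul]
      linear_combination t * ht
    · rw [quadForm_smul, hh, dotProduct_smul, smul_eq_mul]
      rw [hM] at hd
      have : t ^ 2 * (quadForm A0 d + μ * quadForm A1 d) < 0 :=
        mul_neg_of_pos_of_neg (by positivity) hd
      linear_combination this - μ * t * ht
  · push Not at hex
    have hzero : ∀ z, quadForm A1 z = 0 := by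
      intro z
      refine quadForm_eq_zero_of_eventually_eq_zero hA1 w z ?_
      have hc : Continuous fun ε : ℝ => quadForm (A0 + μ • A1) (w + ε • z) :=
        continuous_quadForm.comp (by fun_prop)
      have hc' : Continuous fun ε : ℝ => g ⬝ᵥ (w + ε • z) := by fun_prop
      filter_upwards [hc.continuousAt.eventually_lt continuousAt_const (by simpa using hw),
        hc'.continuousAt.eventually_ne (by simpa using hgw)] with ε h1 h2
      exact hex _ h1 h2
    have : Nontrivial (Fin n) := Fin.nontrivial_iff_two_le.2 hn
    obtain ⟨v, hv0, hvg⟩ := exists_ne_zero_dotProduct_eq_zero g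
    have hgv : g ⬝ᵥ v = 0 := by rw [dotProduct_comm, hvg]
    refine ⟨v, by rw [hzero, hgv]; norm_num, ?_⟩
    rw [hh, hgv]
    obtain ⟨μ0, μ1, hpd⟩ := hjoint
    have hpos : ∀ v, v ≠ 0 → 0 < μ0 * quadForm A0 v := by
      intro v hv0
      have : 0 < quadForm (μ0 • A0 + μ1 • A1) v := by
        simpa [quadForm] using hpd.dotProduct_mulVec_pos hv0
      rwa [quadForm_add_smul, hzero, mul_zero, add_zero] at this
    rw [hM, hzero] at hw
    have hw0 : w ≠ 0 := by
      rintro rfl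
      simp at hgw
    have h1 := hpos w hw0
    have h2 := hpos v hv0
    have h3 : μ0 < 0 := by
      by_contra! h3
      nlinarith
    have h4 : quadForm A0 v < 0 := by
      by_contra! h4
      nlinarith
    linarith

end Local

theorem stmt11 {n : ℕ} (hn : 2 ≤ n)
    (A0 A1 : Matrix (Fin n) (Fin n) ℝ) (hA0 : A0.IsSymm) (hA1 : A1.IsSymm)
    (b0 b1 : Fin n → ℝ) (c1 : ℝ)
    (hjoint : ∃ μ0 μ1 : ℝ, (μ0 • A0 + μ1 • A1).PosDef)
    (xs : Fin n → ℝ) :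
    IsLNGMinGTR A0 A1 b0 b1 c1 xs ↔
      (IsLNGMinGTRE A0 A1 b0 b1 c1 xs ∧
       ∃ μ : ℝ, 0 < μ ∧ (A0.mulVec xs + b0) + μ • (A1.mulVec xs + b1) = 0) := by
  set g := A1 *ᵥ xs + b1 with hg_def
  set h := A0 *ᵥ xs + b0 with hh_def
  simp only [IsLNGMinGTR, IsLNGMinGTRE, IsLocalMinGTR, IsLocalMinGTRE, IsGlobalMinGTR,
    IsGlobalMinGTRE, exists_euclNorm_lt_iff]
  simp only [qf0_add hA0, qf1_add hA1, ← hg_def, ← hh_def, le_add_iff_nonneg_right]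
  constructor
  · rintro ⟨⟨hfeas, hloc⟩, hglob⟩
    have hlt : ∃ d, qf1 A1 b1 c1 xs + (quadForm A1 d + 2 * (g ⬝ᵥ d)) ≤ 0 ∧
        quadForm A0 d + 2 * (h ⬝ᵥ d) < 0 := by
      by_contra! hcon
      refine hglob ⟨hfeas, fun x hx => ?_⟩
      have e0 := qf0_add hA0 b0 xs (x - xs)
      have e1 := qf1_add hA1 b1 xs (x - xs) c1
      rw [add_sub_cancel] at e0 e1
      have := hcon (x - xs) (e1 ▸ hx)
      linarith
    have hact : qf1 A1 b1 c1 xs = 0 := by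
      refine hfeas.antisymm (not_lt.1 fun hneg => ?_)
      have hc : Continuous fun d => qf1 A1 b1 c1 xs + (quadForm A1 d + 2 * (g ⬝ᵥ d)) :=
        continuous_const.add (continuous_quadForm.add (by fun_prop))
      have hev := hc.continuousAt.eventually_lt (x₀ := 0) (continuousAt_const (y := (0 : ℝ)))
        (by simpa [quadForm] using hneg)
      obtain ⟨d, -, hd⟩ := hlt
      refine hd.not_ge (nonneg_of_eventually_of_gradient_eq_zero (A1 := 0) ?_ (by simp [quadForm]))
      filter_upwards [hev, hloc] with d h1 h2 _
      exact h2 h1.le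
    simp only [hact, zero_add] at hloc hlt ⊢
    have hg : g ≠ 0 := by
      intro hg
      obtain ⟨d, hd1, hd⟩ := hlt
      simp only [hg, zero_dotProduct, mul_zero, add_zero] at hloc hd1
      exact hd.not_ge (nonneg_of_eventually_of_gradient_eq_zero hloc hd1)
    obtain ⟨μ, hμ0, hμ, w, hw⟩ := exists_multiplier_pos_of_local_nonglobal hg hloc hlt
    refine ⟨⟨⟨trivial, hloc.mono fun d hd hd' => hd hd'.le⟩, ?_⟩, μ, hμ0, hμ⟩
    rintro ⟨-, hE⟩
    obtain ⟨d, hd1, hd⟩ := exists_neg_of_exists_quadForm_neg hn hA1 hjoint hg hμ hw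
    have := hE (xs + d) (by rw [qf1_add hA1, hact, ← hg_def, hd1, zero_add])
    rw [qf0_add hA0] at this
    linarith
  · rintro ⟨⟨⟨hact, hloc⟩, hglob⟩, μ, hμ0, hμ⟩
    simp only [hact, zero_add] at hloc ⊢
    have hlt : ∃ d, quadForm A1 d + 2 * (g ⬝ᵥ d) = 0 ∧ quadForm A0 d + 2 * (h ⬝ᵥ d) < 0 := by
      by_contra! hcon
      refine hglob ⟨hact, fun x hx => ?_⟩
      have e0 := qf0_add hA0 b0 xs (x - xs)
      have e1 := qf1_add hA1 b1 xs (x - xs) c1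
      rw [add_sub_cancel] at e0 e1
      have := hcon (x - xs) (by linarith)
      linarith
    obtain ⟨d, hd1, hd⟩ := hlt
    have hh : h = -(μ • g) := eq_neg_of_add_eq_zero_left hμ
    have hg : g ≠ 0 := by
      intro hg
      simp only [hh, hg, smul_zero, neg_zero, zero_dotProduct, mul_zero, add_zero] at hloc hd1 hd
      have := (eq_zero_and_nonneg_of_eventually_quadratic_nonneg (p := quadForm A0 d) (r := 0) (by
        filter_upwards [eventually_comp_smul hloc d] with t ht
        simpa [quadForm_smul, hd1] using ht)).2
      linarith
    have hw : quadForm (A0 + μ • A1) d < 0 := by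
      rw [show A0 + μ • A1 = (1 : ℝ) • A0 + μ • A1 by rw [one_smul], quadForm_add_smul]
      rw [hh, neg_dotProduct, smul_dotProduct, smul_eq_mul] at hd
      linear_combination hd + μ * hd1
    refine ⟨⟨le_rfl, eventually_nonneg_of_quadForm_pos_on_tangent hμ0 hμ fun v hv0 hgv =>
      quadForm_pos_on_tangent hA0 hA1 hjoint hg hμ hloc hw hv0 hgv⟩, ?_⟩
    rintro ⟨-, hF⟩
    exact hglob ⟨hact, fun x hx => hF x hx.le⟩
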